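/- Let V be a complex Banach space, m ∈ ℝ, ρ ∈ ℝ with −1 < ρ ≤ 1, and F ∈ S^{m,ρ}(ℝ^{2n}, V). If F(p,x) = F(0,x) for all p, x ∈ ℝ^n (i.e. F is independent of its first n variables), or if F(p,x) = F(p,0) for all p, x ∈ ℝ^n (i.e. F is independent of its last n variables), then the oscillatory integral of F equals its value at the origin: I(F) = F(0,0). In particular, for the constant symbol F ≡ v with v ∈ V one has I(F) = v. -/

import Mathlib

open Filter MeasureTheory

noncomputable def pder {n : ℕ} {V : Type*} [NormedAddCommGroup V] [NormedSpace ℝ V]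
    (i : Fin n) (f : (Fin n → ℝ) → V) : (Fin n → ℝ) → V :=
  fun x => fderiv ℝ f x (Pi.single i 1)

noncomputable def mder {n : ℕ} {V : Type*} [NormedAddCommGroup V] [NormedSpace ℝ V]
    (μ : Fin n → ℕ) (f : (Fin n → ℝ) → V) : (Fin n → ℝ) → V :=
  (List.finRange n).foldr (fun i g => (pder i)^[μ i] g) f

def mOrder {n : ℕ} (μ : Fin n → ℕ) : ℕ := ∑ i, μ i

noncomputable def symWt {n : ℕ} (m ρ : ℝ) (μ : Fin n → ℕ) (x : Fin n → ℝ) : ℝ :=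
  (1 + ‖x‖ ^ 2) ^ (-(m - ρ * (mOrder μ : ℝ)) / 2)

noncomputable def symNorm {n : ℕ} {V : Type*} [NormedAddCommGroup V] [NormedSpace ℝ V]
    (m ρ : ℝ) (μ : Fin n → ℕ) (F : (Fin n → ℝ) → V) : ℝ :=
  ⨆ x : Fin n → ℝ, symWt m ρ μ x * ‖mder μ F x‖

def IsSymbol {n : ℕ} {V : Type*} [NormedAddCommGroup V] [NormedSpace ℝ V]
    (m ρ : ℝ) (F : (Fin n → ℝ) → V) : Prop :=
  ContDiff ℝ (⊤ : ℕ∞) F ∧ ∀ μ : Fin n → ℕ, ∃ C : ℝ, ∀ x, symWt m ρ μ x * ‖mder μ F x‖ ≤ C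
def fstHalf {n : ℕ} (z : Fin (n + n) → ℝ) : Fin n → ℝ := fun i => z (Fin.castAdd n i)

def sndHalf {n : ℕ} (z : Fin (n + n) → ℝ) : Fin n → ℝ := fun i => z (Fin.natAdd n i)

noncomputable def pairM {n : ℕ} (M : Matrix (Fin n) (Fin n) ℝ) (p x : Fin n → ℝ) : ℝ :=
  ∑ i, p i * M.mulVec x i

noncomputable def phase {n : ℕ} (M : Matrix (Fin n) (Fin n) ℝ) (z : Fin (n + n) → ℝ) : ℂ :=
  Complex.exp (Complex.I * (pairM M (fstHalf z) (sndHalf z) : ℂ))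

noncomputable def cutInt {n : ℕ} {V : Type*} [NormedAddCommGroup V] [NormedSpace ℝ V]
    [NormedSpace ℂ V] [IsScalarTower ℝ ℂ V] (M : Matrix (Fin n) (Fin n) ℝ)
    (χ : (Fin (n + n) → ℝ) → ℝ) (z₀ : Fin (n + n) → ℝ) (ε : ℝ)
    (F : (Fin (n + n) → ℝ) → V) : V :=
  ((2 * Real.pi) ^ n)⁻¹ • ∫ z : Fin (n + n) → ℝ, χ (ε • (z - z₀)) • (phase M z • F z)

def IsOscInt {n : ℕ} {V : Type*} [NormedAddCommGroup V] [NormedSpace ℝ V]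
    [NormedSpace ℂ V] [IsScalarTower ℝ ℂ V] (M : Matrix (Fin n) (Fin n) ℝ)
    (F : (Fin (n + n) → ℝ) → V) (v : V) : Prop :=
  ∀ χ : (Fin (n + n) → ℝ) → ℝ, ContDiff ℝ (⊤ : ℕ∞) χ → HasCompactSupport χ →
    (∀ᶠ z in nhds (0 : Fin (n + n) → ℝ), χ z = 1) →
    ∀ z₀ : Fin (n + n) → ℝ,
      Filter.Tendsto (fun ε : ℝ => cutInt M χ z₀ ε F) (nhdsWithin 0 (Set.Ioi 0)) (nhds v)

open Classical in
noncomputable def oscInt {n : ℕ} {V : Type*} [NormedAddCommGroup V] [NormedSpace ℝ V]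
    [NormedSpace ℂ V] [IsScalarTower ℝ ℂ V] (M : Matrix (Fin n) (Fin n) ℝ)
    (F : (Fin (n + n) → ℝ) → V) : V :=
  if h : ∃ v, IsOscInt M F v then h.choose else 0

section PartialFourier

open Real FourierTransform Module
open scoped RealInnerProductSpace Topology ContDiff

variable {E : Type*} [NormedAddCommGroup E] [InnerProductSpace ℝ E]
  {G : Type*} [NormedAddCommGroup G] [NormedSpace ℝ G]

theorem exists_norm_iteratedFDeriv_slice_le {χ : E × G → ℂ} (hχ : ContDiff ℝ ∞ χ)
    (hc : HasCompactSupport χ) (k : ℕ) :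
    ∃ C R : ℝ, 0 ≤ C ∧ ∀ y q, ‖iteratedFDeriv ℝ k (fun q => χ (q, y)) q‖ ≤
      (Metric.closedBall (0 : E) R).indicator (fun _ => C) q := by
  obtain ⟨C, hC⟩ := (hc.iteratedFDeriv (𝕜 := ℝ) k).exists_bound_of_continuous
    (hχ.continuous_iteratedFDeriv (by exact_mod_cast le_top))
  obtain ⟨R, hR⟩ := hc.isCompact.isBounded.subset_closedBall 0
  have hC0 : 0 ≤ C := (norm_nonneg _).trans (hC 0)
  refine ⟨C, R, hC0, fun y q => ?_⟩
  have hslice : iteratedFDeriv ℝ k (fun q => χ (q, y)) q =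
      (iteratedFDeriv ℝ k χ (q, y)).compContinuousLinearMap
        fun _ => ContinuousLinearMap.inl ℝ E G := by
    have h := (ContinuousLinearMap.inl ℝ E G).iteratedFDeriv_comp_right
      (f := fun z => χ (z + (0, y))) (n := ∞) (hχ.comp (contDiff_id.add contDiff_const)) q
      (i := k) (by exact_mod_cast le_top)
    rw [iteratedFDeriv_comp_add_right] at h
    simpa [Function.comp_def] using! h
  rw [hslice]
  by_cases hq : q ∈ Metric.closedBall (0 : E) R
  · rw [Set.indicator_of_mem hq]
    refine (ContinuousMultilinearMap.norm_compContinuousLinearMap_le _ _).trans ?_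
    calc _ ≤ C * ∏ _i : Fin k, (1 : ℝ) := by
          gcongr
          · exact hC _
          · exact ContinuousLinearMap.norm_inl_le_one ℝ E G
      _ = C := by simp
  · have h0 : iteratedFDeriv ℝ k χ (q, y) = 0 := by
      by_contra h
      have hmem := hR (support_iteratedFDeriv_subset k h)
      rw [mem_closedBall_zero_iff] at hmem hq
      exact hq ((le_max_left _ _).trans hmem)
    rw [Set.indicator_of_notMem hq, h0]
    refine le_of_eq (norm_eq_zero.2 ?_)
    ext v
    simp

variable [FiniteDimensional ℝ E] [MeasurableSpace E] [BorelSpace E]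

theorem continuous_fourier_slice {H : Type*} [NormedAddCommGroup H] {χ : E × H → ℂ}
    (hχ : Continuous χ) (hc : HasCompactSupport χ) :
    Continuous fun z : E × H => 𝓕 (fun q => χ (q, z.2)) z.1 := by
  obtain ⟨C, hC⟩ := hc.exists_bound_of_continuous hχ
  obtain ⟨R, hR⟩ := hc.isCompact.isBounded.subset_closedBall 0
  simp only [Real.fourier_eq']
  refine continuous_of_dominated
    (bound := (Metric.closedBall (0 : E) R).indicator fun _ => C) (fun z => ?_) (fun z => ?_) ?_ ?_
  · exact Continuous.aestronglyMeasurable (by fun_prop)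
  · refine Eventually.of_forall fun q => ?_
    rw [norm_smul, Complex.norm_exp_ofReal_mul_I, one_mul]
    by_cases hq : q ∈ Metric.closedBall (0 : E) R
    · rw [Set.indicator_of_mem hq]
      exact hC _
    · rw [Set.indicator_of_notMem hq, norm_le_zero_iff]
      by_contra h
      have hmem := hR (subset_tsupport _ h)
      rw [mem_closedBall_zero_iff] at hmem hq
      exact hq ((le_max_left _ _).trans hmem)
  · exact (integrable_indicator_iff Metric.isClosed_closedBall.measurableSet).2
      (integrableOn_const (isCompact_closedBall 0 R).measure_lt_top.ne)
  · exact Eventually.of_forall fun q => by fun_prop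

theorem exists_norm_pow_mul_fourier_slice_le {χ : E × G → ℂ} (hχ : ContDiff ℝ ∞ χ)
    (hc : HasCompactSupport χ) (k : ℕ) :
    ∃ C : ℝ, ∀ y ξ, ‖ξ‖ ^ k * ‖𝓕 (fun q => χ (q, y)) ξ‖ ≤ C := by
  choose C R hC0 hCR using exists_norm_iteratedFDeriv_slice_le hχ hc
  have hslice (y : G) : ContDiff ℝ ∞ fun q => χ (q, y) :=
    hχ.comp (contDiff_id.prodMk contDiff_const)
  have hind (j : ℕ) : Integrable ((Metric.closedBall (0 : E) (R j)).indicator fun _ => C j) :=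
    (integrable_indicator_iff Metric.isClosed_closedBall.measurableSet).2
      (integrableOn_const (isCompact_closedBall 0 (R j)).measure_lt_top.ne)
  have hcont (y : G) (j : ℕ) : Continuous (iteratedFDeriv ℝ j fun q => χ (q, y)) :=
    (hslice y).continuous_iteratedFDeriv (by exact_mod_cast le_top)
  have hvanish (y : G) (j : ℕ) (q : E) (hq : q ∉ Metric.closedBall (0 : E) (R j)) :
      iteratedFDeriv ℝ j (fun q => χ (q, y)) q = 0 := by
    have := hCR j y q
    rwa [Set.indicator_of_notMem hq, norm_le_zero_iff] at this
  have hint (y : G) (i j : ℕ) :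
      Integrable fun q => ‖q‖ ^ i * ‖iteratedFDeriv ℝ j (fun q => χ (q, y)) q‖ := by
    refine Continuous.integrable_of_hasCompactSupport (by have := hcont y j; fun_prop)
      (HasCompactSupport.intro (isCompact_closedBall (0 : E) (R j)) fun q hq => ?_)
    rw [hvanish y j q hq, norm_zero, mul_zero]
  refine ⟨2 ^ k * ∑ p ∈ Finset.range 1 ×ˢ Finset.range (k + 1),
    ∫ q : E, (Metric.closedBall (0 : E) (R p.2)).indicator (fun _ => C p.2) q, fun y ξ => ?_⟩
  have h := pow_mul_norm_iteratedFDeriv_fourier_le (K := ⊤) (N := ⊤) (hslice y)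
    (fun i j _ _ => hint y i j) (k := 0) (n := k) le_top le_top ξ
  rw [norm_iteratedFDeriv_zero] at h
  refine h.trans ?_
  simp only [Nat.cast_zero, mul_zero, zero_add, pow_zero, one_mul]
  refine mul_le_mul_of_nonneg_left
    (Finset.sum_le_sum fun p hp => integral_mono ?_ (hind _) ?_) (by positivity)
  · have hp0 : p.1 = 0 := by simpa using (Finset.mem_product.1 hp).1
    simpa [hp0] using hint y 0 p.2
  · intro q
    have hp0 : p.1 = 0 := by simpa using (Finset.mem_product.1 hp).1
    simpa [hp0] using hCR p.2 y q

theorem exists_one_add_norm_pow_mul_fourier_slice_le {χ : E × G → ℂ} (hχ : ContDiff ℝ ∞ χ)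
    (hc : HasCompactSupport χ) (N : ℕ) :
    ∃ C : ℝ, 0 ≤ C ∧ ∀ y ξ, (1 + ‖ξ‖) ^ N * ‖𝓕 (fun q => χ (q, y)) ξ‖ ≤ C := by
  obtain ⟨C₀, h₀⟩ := exists_norm_pow_mul_fourier_slice_le hχ hc 0
  obtain ⟨C₁, h₁⟩ := exists_norm_pow_mul_fourier_slice_le hχ hc N
  have hbound (y : G) (ξ : E) :
      (1 + ‖ξ‖) ^ N * ‖𝓕 (fun q => χ (q, y)) ξ‖ ≤ 2 ^ (N - 1) * (C₀ + C₁) := by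
    calc _ ≤ (2 ^ (N - 1) * (1 ^ N + ‖ξ‖ ^ N)) * ‖𝓕 (fun q => χ (q, y)) ξ‖ := by
          gcongr
          exact add_pow_le zero_le_one (norm_nonneg _) N
      _ = 2 ^ (N - 1) * (‖ξ‖ ^ 0 * ‖𝓕 (fun q => χ (q, y)) ξ‖ +
            ‖ξ‖ ^ N * ‖𝓕 (fun q => χ (q, y)) ξ‖) := by ring
      _ ≤ _ := by
          gcongr
          · exact h₀ y ξ
          · exact h₁ y ξ
  exact ⟨_, le_trans (by positivity) (hbound 0 0), hbound⟩

theorem integral_fourier_slice_zero {χ : E × G → ℂ} (hχ : ContDiff ℝ ∞ χ)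
    (hc : HasCompactSupport χ) :
    ∫ ξ, 𝓕 (fun q => χ (q, 0)) ξ = χ 0 := by
  have hcont : Continuous fun q => χ (q, 0) := hχ.continuous.comp (by fun_prop)
  have hcs : HasCompactSupport fun q => χ (q, 0) :=
    hc.comp_isClosedEmbedding (Function.LeftInverse.isClosedEmbedding
      (f := Prod.fst) (g := fun q => (q, (0 : G))) (fun _ => rfl) continuous_fst (by fun_prop))
  obtain ⟨C, -, hC⟩ := exists_one_add_norm_pow_mul_fourier_slice_le hχ hc (finrank ℝ E + 1)
  have hint : Integrable (𝓕 fun q => χ (q, 0)) := by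
    refine ((integrable_one_add_norm (μ := (volume : Measure E))
      (r := ((finrank ℝ E + 1 : ℕ) : ℝ)) (by simp)).const_mul C).mono'
      ((continuous_fourier_slice hχ.continuous hc).comp
        (continuous_id.prodMk continuous_const)).aestronglyMeasurable
      (Eventually.of_forall fun ξ => ?_)
    rw [rpow_neg (by positivity), rpow_natCast, ← div_eq_mul_inv, le_div_iff₀ (by positivity),
      mul_comm]
    exact hC 0 ξ
  have h := congrFun (hcont.fourierInv_fourier_eq
    (hcont.integrable_of_hasCompactSupport hcs) hint) 0
  simp only [Real.fourierInv_eq', inner_zero_right, mul_zero, Complex.ofReal_zero, zero_mul,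
    Complex.exp_zero, one_smul] at h
  exact h

variable {V : Type*} [NormedAddCommGroup V] [NormedSpace ℂ V]

theorem integral_comp_smul_sub (g : E → V) (c : ℝ) (a : E) :
    ∫ q, g (c • (q - a)) = |(c ^ finrank ℝ E)⁻¹| • ∫ q, g q := by
  rw [integral_sub_right_eq_self (fun q => g (c • q)) a, Measure.integral_comp_smul]

theorem integral_cutoff_exp_smul [CompleteSpace V] {χ : E × E → ℂ} (hχ : Continuous χ)
    (hc : HasCompactSupport χ) (L : E ≃L[ℝ] E) (hL : MeasurePreserving L) {f : E → V}
    (hf : Continuous f) (w₀ : E × E) {ε : ℝ} (hε : 0 < ε) :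
    ((2 * π) ^ finrank ℝ E)⁻¹ • ∫ w : E × E, χ (ε • (w - w₀)) •
        (Complex.exp (Complex.I * (⟪w.1, L w.2⟫ : ℝ)) • f w.2) =
      ∫ ξ, (Complex.exp (Complex.I * (⟪w₀.1, (-(2 * π * ε)) • ξ⟫ : ℝ)) *
        𝓕 (fun q => χ (q, ε • (L.symm ((-(2 * π * ε)) • ξ) - w₀.2))) ξ) •
          f (L.symm ((-(2 * π * ε)) • ξ)) := by
  have hcs : HasCompactSupport fun w : E × E => χ (ε • (w - w₀)) :=
    hc.comp_homeomorph ((Homeomorph.subRight w₀).trans (Homeomorph.smulOfNeZero ε hε.ne'))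
  have hint : Integrable (fun w : E × E => χ (ε • (w - w₀)) •
      (Complex.exp (Complex.I * (⟪w.1, L w.2⟫ : ℝ)) • f w.2)) (volume.prod volume) :=
    Continuous.integrable_of_hasCompactSupport (by fun_prop) hcs.smul_right
  rw [Measure.volume_eq_prod, integral_prod_symm _ hint]
  have hinner (x : E) : ∫ q : E, χ (ε • ((q, x) - w₀)) •
      (Complex.exp (Complex.I * (⟪q, L x⟫ : ℝ)) • f x) =
      (ε ^ finrank ℝ E)⁻¹ • (Complex.exp (Complex.I * (⟪w₀.1, L x⟫ : ℝ)) *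
        𝓕 (fun q => χ (q, ε • (x - w₀.2))) ((-(2 * π * ε)⁻¹) • L x)) • f x := by
    have h := integral_comp_smul_sub (fun s : E => χ (s, ε • (x - w₀.2)) •
      (Complex.exp (Complex.I * (⟪ε⁻¹ • s + w₀.1, L x⟫ : ℝ)) • f x)) ε w₀.1
    rw [abs_of_nonneg (by positivity)] at h
    convert! h using 2
    · ext q
      simp [smul_smul, inv_mul_cancel₀ hε.ne']
      rfl
    · rw [Real.fourier_eq', ← smul_eq_mul, ← integral_smul, ← integral_smul_const]
      congr 1
      ext s
      simp only [smul_smul, smul_eq_mul]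
      congr 1
      rw [← mul_assoc, ← Complex.exp_add, mul_comm]
      congr 2
      simp only [inner_add_left, inner_smul_left, inner_smul_right]
      push_cast
      have : (π : ℂ) ≠ 0 := by exact_mod_cast pi_ne_zero
      have : (ε : ℂ) ≠ 0 := by exact_mod_cast hε.ne'
      simp
      field_simp
      ring
  simp only [hinner]
  rw [integral_smul, smul_smul, ← mul_inv, ← mul_pow]
  have hL' : MeasurePreserving L.symm := hL.symm L.toHomeomorph.toMeasurableEquiv
  have hc0 : -(2 * π * ε) ≠ 0 := by have := pi_pos; simp [hε.ne', this.ne']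
  rw [← hL'.integral_comp L.symm.toHomeomorph.measurableEmbedding]
  have h := Measure.integral_comp_smul (volume : Measure E) (fun u : E =>
    (Complex.exp (Complex.I * (⟪w₀.1, L (L.symm u)⟫ : ℝ)) *
        𝓕 (fun q => χ (q, ε • (L.symm u - w₀.2))) ((-(2 * π * ε)⁻¹) • L (L.symm u))) •
          f (L.symm u)) (-(2 * π * ε))
  rw [abs_inv, abs_pow, abs_neg, abs_of_pos (by have := pi_pos; positivity)] at h
  rw [← h]
  congr 1
  ext ξ
  have : -(2 * π * ε)⁻¹ * -(2 * π * ε) = 1 := by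
    rw [neg_mul_neg, inv_mul_cancel₀ (by simpa using hc0)]
  simp only [L.apply_symm_apply, smul_smul, this, one_smul]

theorem tendsto_integral_cutoff_exp_smul [CompleteSpace V] {χ : E × E → ℂ}
    (hχ : ContDiff ℝ ∞ χ) (hc : HasCompactSupport χ) (L : E ≃L[ℝ] E)
    (hL : MeasurePreserving L) {f : E → V} (hf : Continuous f) {C : ℝ} {K : ℕ}
    (hfC : ∀ x, ‖f x‖ ≤ C * (1 + ‖x‖) ^ K) (w₀ : E × E) :
    Tendsto (fun ε : ℝ => ((2 * π) ^ finrank ℝ E)⁻¹ • ∫ w : E × E, χ (ε • (w - w₀)) •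
        (Complex.exp (Complex.I * (⟪w.1, L w.2⟫ : ℝ)) • f w.2))
      (𝓝[>] 0) (𝓝 (χ 0 • f 0)) := by
  have hev : ∀ᶠ ε : ℝ in 𝓝[>] 0, 0 < ε ∧ ε < 1 := Ioo_mem_nhdsGT one_pos
  refine Tendsto.congr' (hev.mono fun ε hε =>
    (integral_cutoff_exp_smul hχ.continuous hc L hL hf w₀ hε.1).symm) ?_
  rw [← integral_fourier_slice_zero hχ hc, ← integral_smul_const]
  have hcont : Continuous fun z : E × E => 𝓕 (fun q => χ (q, z.2)) z.1 :=
    continuous_fourier_slice hχ.continuous hc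
  obtain ⟨C', hC'0, hC'⟩ := exists_one_add_norm_pow_mul_fourier_slice_le hχ hc
    (K + (finrank ℝ E + 1))
  have hC0 : 0 ≤ C := by simpa using (norm_nonneg _).trans (hfC 0)
  obtain ⟨B, hB1, hB⟩ : ∃ B : ℝ, 1 ≤ B ∧ ∀ ε : ℝ, 0 < ε → ε < 1 → ∀ ξ : E,
      1 + ‖L.symm ((-(2 * π * ε)) • ξ)‖ ≤ B * (1 + ‖ξ‖) := by
    refine ⟨1 + ‖(L.symm : E →L[ℝ] E)‖ * (2 * π), ?_, fun ε h0 h1 ξ => ?_⟩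
    · have := pi_pos
      have : 0 ≤ ‖(L.symm : E →L[ℝ] E)‖ * (2 * π) := by positivity
      linarith
    · have hle : ‖L.symm ((-(2 * π * ε)) • ξ)‖ ≤ ‖(L.symm : E →L[ℝ] E)‖ * (2 * π) * ‖ξ‖ := by
        have hε : 2 * π * ε ≤ 2 * π := by nlinarith [pi_pos]
        have hn : ‖(-(2 * π * ε)) • ξ‖ = 2 * π * ε * ‖ξ‖ := by
          rw [norm_smul, norm_neg, Real.norm_of_nonneg (by positivity)]
        calc _ ≤ ‖(L.symm : E →L[ℝ] E)‖ * ‖(-(2 * π * ε)) • ξ‖ :=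
              (L.symm : E →L[ℝ] E).le_opNorm _
          _ ≤ ‖(L.symm : E →L[ℝ] E)‖ * (2 * π * ‖ξ‖) := by
              rw [hn]
              gcongr
          _ = _ := by ring
      have : 0 ≤ ‖(L.symm : E →L[ℝ] E)‖ * (2 * π) := by positivity
      nlinarith [norm_nonneg ξ]
  refine tendsto_integral_filter_of_dominated_convergence
    (fun ξ => C' * (C * B ^ K) * (1 + ‖ξ‖) ^ (-((finrank ℝ E + 1 : ℕ) : ℝ))) ?_ ?_ ?_ ?_
  · refine Eventually.of_forall fun ε => Continuous.aestronglyMeasurable ?_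
    have := hcont.comp (g := fun z : E × E => 𝓕 (fun q => χ (q, z.2)) z.1)
      (f := fun ξ : E => (ξ, ε • (L.symm ((-(2 * π * ε)) • ξ) - w₀.2))) (by fun_prop)
    simp only [Function.comp_def] at this
    exact (Continuous.mul (by fun_prop) this).smul (hf.comp (by fun_prop))
  · refine hev.mono fun ε hε => Eventually.of_forall fun ξ => ?_
    rw [norm_smul, norm_mul, mul_comm Complex.I, Complex.norm_exp_ofReal_mul_I, one_mul]
    have h1 := hC' (ε • (L.symm ((-(2 * π * ε)) • ξ) - w₀.2)) ξ
    have h2 : ‖f (L.symm ((-(2 * π * ε)) • ξ))‖ ≤ C * B ^ K * (1 + ‖ξ‖) ^ K := by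
      refine (hfC _).trans ?_
      rw [mul_assoc C, ← mul_pow]
      gcongr
      exact hB ε hε.1 hε.2 ξ
    rw [rpow_neg (by positivity), rpow_natCast, ← div_eq_mul_inv, le_div_iff₀ (by positivity)]
    rw [pow_add] at h1
    calc _ ≤ ‖𝓕 (fun q => χ (q, ε • (L.symm ((-(2 * π * ε)) • ξ) - w₀.2))) ξ‖ *
          (C * B ^ K * (1 + ‖ξ‖) ^ K) * (1 + ‖ξ‖) ^ (finrank ℝ E + 1) := by gcongr
      _ = (1 + ‖ξ‖) ^ K * (1 + ‖ξ‖) ^ (finrank ℝ E + 1) *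
          ‖𝓕 (fun q => χ (q, ε • (L.symm ((-(2 * π * ε)) • ξ) - w₀.2))) ξ‖ * (C * B ^ K) := by
          ring
      _ ≤ C' * (C * B ^ K) := by gcongr
  · exact (integrable_one_add_norm (by simp)).const_mul _
  · refine Eventually.of_forall fun ξ => ?_
    have h1 := hcont.comp (g := fun z : E × E => 𝓕 (fun q => χ (q, z.2)) z.1)
      (f := fun ε : ℝ => (ξ, ε • (L.symm ((-(2 * π * ε)) • ξ) - w₀.2))) (by fun_prop)
    simp only [Function.comp_def] at h1
    have h2 : Continuous fun ε : ℝ =>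
        (Complex.exp (Complex.I * (⟪w₀.1, (-(2 * π * ε)) • ξ⟫ : ℝ)) *
        𝓕 (fun q => χ (q, ε • (L.symm ((-(2 * π * ε)) • ξ) - w₀.2))) ξ) •
          f (L.symm ((-(2 * π * ε)) • ξ)) :=
      (Continuous.mul (by fun_prop) h1).smul (hf.comp (by fun_prop))
    simpa using (h2.tendsto 0).mono_left nhdsWithin_le_nhds

end PartialFourier

section OscillatoryIntegral

open Module Topology
open scoped RealInnerProductSpace ContDiff

/-- The identification of `ℝⁿ × ℝⁿ`, with Euclidean factors, with `ℝ²ⁿ`. -/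
noncomputable def appendEquiv (n : ℕ) :
    (EuclideanSpace ℝ (Fin n) × EuclideanSpace ℝ (Fin n)) ≃L[ℝ] (Fin (n + n) → ℝ) :=
  ((EuclideanSpace.equiv (Fin n) ℝ).prodCongr (EuclideanSpace.equiv (Fin n) ℝ)).trans
    ((ContinuousLinearEquiv.sumPiEquivProdPi ℝ (Fin n) (Fin n) fun _ => ℝ).symm.trans
      (ContinuousLinearEquiv.piCongrLeft ℝ (fun _ => ℝ) finSumFinEquiv))

@[simp]
theorem fstHalf_appendEquiv {n : ℕ} (w : EuclideanSpace ℝ (Fin n) × EuclideanSpace ℝ (Fin n)) :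
    fstHalf (appendEquiv n w) = w.1.ofLp := by
  ext i
  exact Equiv.piCongrLeft_apply_apply (fun _ => ℝ) finSumFinEquiv _ (Sum.inl i)

@[simp]
theorem sndHalf_appendEquiv {n : ℕ} (w : EuclideanSpace ℝ (Fin n) × EuclideanSpace ℝ (Fin n)) :
    sndHalf (appendEquiv n w) = w.2.ofLp := by
  ext i
  exact Equiv.piCongrLeft_apply_apply (fun _ => ℝ) finSumFinEquiv _ (Sum.inr i)

theorem measurePreserving_appendEquiv (n : ℕ) : MeasurePreserving (appendEquiv n) :=
  (volume_measurePreserving_piCongrLeft (fun _ => ℝ) finSumFinEquiv).comp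
    ((volume_measurePreserving_sumPiEquivProdPi_symm fun _ : Fin n ⊕ Fin n => ℝ).comp
      ((PiLp.volume_preserving_ofLp (Fin n)).prod (PiLp.volume_preserving_ofLp (Fin n))))

theorem append_zero_eq {n : ℕ} (w : EuclideanSpace ℝ (Fin n)) :
    Fin.append w.ofLp (0 : Fin n → ℝ) = appendEquiv n (w, 0) := by
  refine funext fun i => Fin.addCases (fun j => ?_) (fun j => ?_) i
  · rw [Fin.append_left]
    exact (congrFun (fstHalf_appendEquiv (w, 0)) j).symm
  · rw [Fin.append_right]
    exact (congrFun (sndHalf_appendEquiv (w, 0)) j).symm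

theorem zero_append_eq {n : ℕ} (w : EuclideanSpace ℝ (Fin n)) :
    Fin.append (0 : Fin n → ℝ) w.ofLp = appendEquiv n (0, w) := by
  refine funext fun i => Fin.addCases (fun j => ?_) (fun j => ?_) i
  · rw [Fin.append_left]
    exact (congrFun (fstHalf_appendEquiv (0, w)) j).symm
  · rw [Fin.append_right]
    exact (congrFun (sndHalf_appendEquiv (0, w)) j).symm

theorem exists_measurePreserving_toEuclidean {n : ℕ} (M : Matrix (Fin n) (Fin n) ℝ)
    (hM : |M.det| = 1) :
    ∃ L : EuclideanSpace ℝ (Fin n) ≃L[ℝ] EuclideanSpace ℝ (Fin n),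
      MeasurePreserving L ∧ ∀ x, (L x).ofLp = M.mulVec x.ofLp := by
  have hdet : LinearMap.det (Matrix.toLpLin 2 2 M) = M.det := LinearMap.det_toLpLin 2 M
  have hne : M.det ≠ 0 := fun h => by simp [h] at hM
  refine ⟨(LinearMap.equivOfDetNeZero (Matrix.toLpLin 2 2 M)
    (hdet ▸ hne)).toContinuousLinearEquiv, ?_, fun x => rfl⟩
  refine ⟨ContinuousLinearEquiv.continuous _ |>.measurable, ?_⟩
  have h := Measure.map_linearMap_addHaar_eq_smul_addHaar
    (volume : Measure (EuclideanSpace ℝ (Fin n))) (f := Matrix.toLpLin 2 2 M) (hdet ▸ hne)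
  rw [hdet, abs_inv, hM, inv_one, ENNReal.ofReal_one, one_smul] at h
  exact h

theorem IsSymbol.exists_norm_le {n : ℕ} {V : Type*} [NormedAddCommGroup V] [NormedSpace ℝ V]
    {m ρ : ℝ} {F : (Fin n → ℝ) → V} (hF : IsSymbol m ρ F) :
    ∃ (C : ℝ) (K : ℕ), ∀ z, ‖F z‖ ≤ C * (1 + ‖z‖) ^ K := by
  obtain ⟨C, hC⟩ := hF.2 0
  have hmder : mder (0 : Fin n → ℕ) F = F := by
    have (l : List (Fin n)) :
        l.foldr (fun i g => (pder i)^[(0 : Fin n → ℕ) i] g) F = F := by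
      induction l with
      | nil => rfl
      | cons i l ih => simp
    exact this _
  have hC0 : 0 ≤ C := le_trans (by unfold symWt; positivity) (hC 0)
  refine ⟨C, ⌈|m|⌉₊, fun z => ?_⟩
  have h := hC z
  rw [hmder, symWt] at h
  simp only [mOrder, Pi.zero_apply, Finset.sum_const_zero, Nat.cast_zero, mul_zero, sub_zero] at h
  have hz := norm_nonneg z
  have hb : (1 : ℝ) ≤ 1 + ‖z‖ ^ 2 := by nlinarith
  have hinv : (1 + ‖z‖ ^ 2) ^ (m / 2) * (1 + ‖z‖ ^ 2) ^ (-m / 2) = 1 := by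
    rw [← Real.rpow_add (by positivity)]
    ring_nf
    simp
  have hle : (1 + ‖z‖ ^ 2) ^ (m / 2) ≤ (1 + ‖z‖) ^ ⌈|m|⌉₊ := by
    calc (1 + ‖z‖ ^ 2) ^ (m / 2) ≤ (1 + ‖z‖ ^ 2) ^ (|m| / 2) :=
          Real.rpow_le_rpow_of_exponent_le hb (by have := le_abs_self m; linarith)
      _ ≤ ((1 + ‖z‖) ^ 2) ^ (|m| / 2) := by
          gcongr
          nlinarith
      _ = (1 + ‖z‖) ^ |m| := by
          rw [← Real.rpow_natCast, ← Real.rpow_mul (by positivity)]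
          congr 1
          push_cast
          ring
      _ ≤ (1 + ‖z‖) ^ (⌈|m|⌉₊ : ℝ) :=
          Real.rpow_le_rpow_of_exponent_le (by linarith) (Nat.le_ceil _)
      _ = _ := Real.rpow_natCast _ _
  calc ‖F z‖ = (1 + ‖z‖ ^ 2) ^ (m / 2) * ((1 + ‖z‖ ^ 2) ^ (-m / 2) * ‖F z‖) := by
        rw [← mul_assoc, hinv, one_mul]
    _ ≤ (1 + ‖z‖) ^ ⌈|m|⌉₊ * C := by gcongr
    _ = _ := mul_comm _ _

theorem normedSpace_eq_complexToReal {V : Type*} [NormedAddCommGroup V] (i : NormedSpace ℝ V)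
    [NormedSpace ℂ V] [IsScalarTower ℝ ℂ V] : i = NormedSpace.complexToReal := by
  apply NormedSpace.ext
  funext r v
  exact (algebraMap_smul ℂ r v).symm

theorem isOscInt_of_comp {n : ℕ} {V : Type*} [NormedAddCommGroup V] [NormedSpace ℝ V]
    [NormedSpace ℂ V] [IsScalarTower ℝ ℂ V] [CompleteSpace V]
    {M : Matrix (Fin n) (Fin n) ℝ} {m ρ : ℝ} {F : (Fin (n + n) → ℝ) → V} (hF : IsSymbol m ρ F)
    (Φ : (EuclideanSpace ℝ (Fin n) × EuclideanSpace ℝ (Fin n)) ≃L[ℝ] (Fin (n + n) → ℝ))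
    (hΦ : MeasurePreserving Φ) (L : EuclideanSpace ℝ (Fin n) ≃L[ℝ] EuclideanSpace ℝ (Fin n))
    (hL : MeasurePreserving L)
    (hphase : ∀ w, pairM M (fstHalf (Φ w)) (sndHalf (Φ w)) = ⟪w.1, L w.2⟫)
    (hconst : ∀ w, F (Φ w) = F (Φ (0, w.2))) : IsOscInt M F (F 0) := by
  intro χ hχ hc hχ1 z₀
  obtain rfl := normedSpace_eq_complexToReal ‹NormedSpace ℝ V›
  obtain ⟨C, K, hCK⟩ := hF.exists_norm_le
  have hC0 : 0 ≤ C := by simpa using (norm_nonneg _).trans (hCK 0)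
  set B : ℝ := 1 + ‖Φ.toContinuousLinearMap‖ with hB
  have hgrowth (x : EuclideanSpace ℝ (Fin n)) :
      ‖F (Φ (0, x))‖ ≤ C * B ^ K * (1 + ‖x‖) ^ K := by
    refine (hCK _).trans ?_
    rw [mul_assoc C, ← mul_pow]
    gcongr
    have h := Φ.toContinuousLinearMap.le_opNorm ((0 : EuclideanSpace ℝ (Fin n)), x)
    have hx : ‖((0 : EuclideanSpace ℝ (Fin n)), x)‖ = ‖x‖ := by simp [Prod.norm_def]
    rw [hx] at h
    have h' : ‖Φ (0, x)‖ ≤ ‖Φ.toContinuousLinearMap‖ * ‖x‖ := h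
    nlinarith [norm_nonneg x, norm_nonneg Φ.toContinuousLinearMap]
  have hlim := tendsto_integral_cutoff_exp_smul (χ := fun w => (χ (Φ w) : ℂ))
    (Complex.ofRealCLM.contDiff.comp (hχ.comp Φ.contDiff))
    ((hc.comp_homeomorph Φ.toHomeomorph).comp_left Complex.ofReal_zero) L hL
    (f := fun x => F (Φ (0, x)))
    (hF.1.continuous.comp (Φ.continuous.comp (by fun_prop))) hgrowth (Φ.symm z₀)
  simp only [Prod.mk_zero_zero, map_zero, hχ1.self_of_nhds, Complex.ofReal_one, one_smul,
    finrank_euclideanSpace, Fintype.card_fin] at hlim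
  refine hlim.congr fun ε => ?_
  rw [cutInt, ← hΦ.integral_comp Φ.toHomeomorph.measurableEmbedding]
  congr 2
  ext w
  rw [phase, hphase, hconst w, Complex.coe_smul]
  simp

theorem IsOscInt.eq {n : ℕ} {V : Type*} [NormedAddCommGroup V] [NormedSpace ℝ V]
    [NormedSpace ℂ V] [IsScalarTower ℝ ℂ V] {M : Matrix (Fin n) (Fin n) ℝ}
    {F : (Fin (n + n) → ℝ) → V} {v v' : V} (h : IsOscInt M F v) (h' : IsOscInt M F v') :
    v = v' := by
  let χ : ContDiffBump (0 : Fin (n + n) → ℝ) := ⟨1, 2, one_pos, one_lt_two⟩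
  exact tendsto_nhds_unique
    (h χ χ.contDiff χ.hasCompactSupport χ.eventuallyEq_one 0)
    (h' χ χ.contDiff χ.hasCompactSupport χ.eventuallyEq_one 0)

theorem IsOscInt.oscInt_eq {n : ℕ} {V : Type*} [NormedAddCommGroup V] [NormedSpace ℝ V]
    [NormedSpace ℂ V] [IsScalarTower ℝ ℂ V] {M : Matrix (Fin n) (Fin n) ℝ}
    {F : (Fin (n + n) → ℝ) → V} {v : V} (h : IsOscInt M F v) : oscInt M F = v := by
  have hex : ∃ v, IsOscInt M F v := ⟨v, h⟩
  rw [oscInt, dif_pos hex]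
  exact hex.choose_spec.eq h

theorem pairM_eq_pairM_transpose {n : ℕ} (M : Matrix (Fin n) (Fin n) ℝ) (p x : Fin n → ℝ) :
    pairM M p x = pairM M.transpose x p := by
  change p ⬝ᵥ M.mulVec x = x ⬝ᵥ M.transpose.mulVec p
  rw [Matrix.mulVec_transpose, Matrix.dotProduct_mulVec, dotProduct_comm]

theorem pairM_eq_inner {n : ℕ} (M : Matrix (Fin n) (Fin n) ℝ) {p x y : EuclideanSpace ℝ (Fin n)}
    (h : y.ofLp = M.mulVec x.ofLp) : pairM M p.ofLp x.ofLp = ⟪p, y⟫ := by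
  simp [pairM, PiLp.inner_apply, h, mul_comm]

theorem isOscInt_of_const_half {n : ℕ} {V : Type*} [NormedAddCommGroup V] [NormedSpace ℝ V]
    [NormedSpace ℂ V] [IsScalarTower ℝ ℂ V] [CompleteSpace V]
    {M : Matrix (Fin n) (Fin n) ℝ} (hM : |M.det| = 1)
    {m ρ : ℝ} {F : (Fin (n + n) → ℝ) → V} (hF : IsSymbol m ρ F)
    (hconst : (∀ z : Fin (n + n) → ℝ, F z = F (Fin.append (0 : Fin n → ℝ) (sndHalf z))) ∨
      (∀ z : Fin (n + n) → ℝ, F z = F (Fin.append (fstHalf z) (0 : Fin n → ℝ)))) :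
    IsOscInt M F (F 0) := by
  rcases hconst with h | h
  · obtain ⟨L, hL, hLM⟩ := exists_measurePreserving_toEuclidean M hM
    refine isOscInt_of_comp hF (appendEquiv n) (measurePreserving_appendEquiv n) L hL
      (fun w => ?_) (fun w => ?_)
    · rw [fstHalf_appendEquiv, sndHalf_appendEquiv, pairM_eq_inner M (hLM w.2)]
    · rw [h, sndHalf_appendEquiv, zero_append_eq]
  · obtain ⟨L, hL, hLM⟩ := exists_measurePreserving_toEuclidean M.transpose
      (by rwa [Matrix.det_transpose])
    refine isOscInt_of_comp hF ((ContinuousLinearEquiv.prodComm ℝ _ _).trans (appendEquiv n))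
      ((measurePreserving_appendEquiv n).comp Measure.measurePreserving_swap) L hL
      (fun w => ?_) (fun w => ?_)
    · change pairM M (fstHalf (appendEquiv n w.swap)) (sndHalf (appendEquiv n w.swap)) = _
      rw [fstHalf_appendEquiv, sndHalf_appendEquiv, pairM_eq_pairM_transpose]
      exact pairM_eq_inner M.transpose (hLM w.2)
    · change F (appendEquiv n w.swap) = F (appendEquiv n (w.2, 0))
      rw [h, fstHalf_appendEquiv, append_zero_eq]
      rfl

end OscillatoryIntegral

theorem statement15 {n : ℕ} {V : Type*} [NormedAddCommGroup V] [NormedSpace ℝ V]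
    [NormedSpace ℂ V] [IsScalarTower ℝ ℂ V] [CompleteSpace V]
    (M : Matrix (Fin n) (Fin n) ℝ) (hM : |M.det| = 1)
    (m ρ : ℝ) (hρ1 : -1 < ρ) (hρ2 : ρ ≤ 1)
    (F : (Fin (n + n) → ℝ) → V) (hF : IsSymbol m ρ F)
    (hconst : (∀ z : Fin (n + n) → ℝ, F z = F (Fin.append (0 : Fin n → ℝ) (sndHalf z))) ∨
      (∀ z : Fin (n + n) → ℝ, F z = F (Fin.append (fstHalf z) (0 : Fin n → ℝ)))) :
    oscInt M F = F 0 ∧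
    ∀ v : V, IsSymbol m ρ (fun _ : Fin (n + n) → ℝ => v) →
      oscInt M (fun _ : Fin (n + n) → ℝ => v) = v := by
  exact ⟨(isOscInt_of_const_half hM hF hconst).oscInt_eq, fun v hv =>
    (isOscInt_of_const_half hM hv (Or.inl fun _ => rfl)).oscInt_eq⟩
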